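/- Let λ be an orthogonal partition and let i = (i_1, …, i_s) be a maximal admissible sequence for λ under the orthogonal reduction rules. Then for every permutation σ of {1, …, s}, the sequence (i_{σ(1)}, …, i_{σ(s)}) is also a maximal admissible sequence for λ, and the resulting partition λ^{(i_{σ(1)}, …, i_{σ(s)})} is equal to λ^{i}. -/

import Mathlib

/-- A type 1 reduction can be made to `lam` at position `i` (positions are 1-indexed). -/
def Type1At (lam : ℕ → ℕ) (i : ℕ) : Prop :=
  1 ≤ i ∧ lam (i + 1) + 2 ≤ lam i

/-- A type 2 reduction can be made to `lam` at position `i`, where `par` is the parity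
condition on `lam i` (`Even` in the symplectic case, `Odd` in the orthogonal case).
The inequality `lam 0 > lam 1` is regarded as automatically true. -/
def Type2At (par : ℕ → Prop) (lam : ℕ → ℕ) (i : ℕ) : Prop :=
  1 ≤ i ∧ par (lam i) ∧ (2 ≤ i → lam i < lam (i - 1)) ∧
    lam i = lam (i + 1) ∧ lam (i + 2) < lam (i + 1)

/-- `i` is an admissible position for `lam`. -/
def AdmissibleAt (par : ℕ → Prop) (lam : ℕ → ℕ) (i : ℕ) : Prop :=
  Type1At lam i ∨ Type2At par lam i

/-- The result of a type 1 reduction at position `i`. -/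
def red1 (lam : ℕ → ℕ) (i : ℕ) : ℕ → ℕ :=
  fun j => if 1 ≤ j ∧ j ≤ i then lam j - 2 else lam j

/-- The result of a type 2 reduction at position `i`. -/
def red2 (lam : ℕ → ℕ) (i : ℕ) : ℕ → ℕ :=
  fun j => if 1 ≤ j ∧ j < i then lam j - 2
    else if j = i ∨ j = i + 1 then lam j - 1 else lam j

/-- The reduction of `lam` at position `i`: of type 1 when a type 1 reduction can be made,
and otherwise of type 2 (at an admissible position at most one type of reduction applies). -/
def reduceAt (lam : ℕ → ℕ) (i : ℕ) : ℕ → ℕ :=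
  if lam (i + 1) + 2 ≤ lam i then red1 lam i else red2 lam i

/-- The partition `lam ^ l`, obtained by successively reducing at the positions listed in `l`. -/
def reduceList : (ℕ → ℕ) → List ℕ → (ℕ → ℕ)
  | lam, [] => lam
  | lam, i :: rest => reduceList (reduceAt lam i) rest

/-- `l` is an admissible sequence for `lam`. -/
def AdmissibleSeq (par : ℕ → Prop) : (ℕ → ℕ) → List ℕ → Prop
  | _, [] => True
  | lam, i :: rest => AdmissibleAt par lam i ∧ AdmissibleSeq par (reduceAt lam i) rest

/-- `l` is a maximal admissible sequence for `lam`. -/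
def MaxAdmissibleSeq (par : ℕ → Prop) (lam : ℕ → ℕ) (l : List ℕ) : Prop :=
  AdmissibleSeq par lam l ∧ ∀ i, ¬ AdmissibleAt par (reduceList lam l) i

/-- `lam` (1-indexed) is a partition: weakly decreasing with finitely many nonzero entries. -/
def IsPartition (lam : ℕ → ℕ) : Prop :=
  (∀ i, 1 ≤ i → lam (i + 1) ≤ lam i) ∧ ∃ N, ∀ i, N ≤ i → lam i = 0

/-- A symplectic partition: a partition of an even number in which every odd part occurs
with even multiplicity. -/
def IsSymplectic (lam : ℕ → ℕ) : Prop :=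
  IsPartition lam ∧
    (∃ N, (∀ i, N < i → lam i = 0) ∧ Even (∑ i ∈ Finset.Icc 1 N, lam i)) ∧
    ∀ p, Odd p → Even {i : ℕ | 1 ≤ i ∧ lam i = p}.ncard

/-- An orthogonal partition: a partition in which every positive even part occurs with
even multiplicity. -/
def IsOrthogonal (lam : ℕ → ℕ) : Prop :=
  IsPartition lam ∧
    ∀ p, 0 < p → Even p → Even {i : ℕ | 1 ≤ i ∧ lam i = p}.ncard

/-- The partition `(2r, 2r-2, ..., 4, 2)`. -/
def staircase (r : ℕ) : ℕ → ℕ :=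
  fun j => if 1 ≤ j ∧ j ≤ r then 2 * (r + 1 - j) else 0

/-- The partition `(2r-1, 2r-3, ..., 3, 1)`. -/
def oddStaircase (r : ℕ) : ℕ → ℕ :=
  fun j => if 1 ≤ j ∧ j ≤ r then 2 * (r + 1 - j) - 1 else 0

/-- `lam` is weakly decreasing from position `1` on. -/
def WeaklyDecreasing (lam : ℕ → ℕ) : Prop :=
  ∀ i, 1 ≤ i → lam (i + 1) ≤ lam i

theorem WeaklyDecreasing.le {lam : ℕ → ℕ} (h : WeaklyDecreasing lam) {i j : ℕ} (hi : 1 ≤ i)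
    (hij : i ≤ j) : lam j ≤ lam i := by
  induction j, hij using Nat.le_induction with
  | base => exact le_rfl
  | succ k hk ih => exact (h k (hi.trans hk)).trans ih

theorem Type1At.reduceAt_eq {lam : ℕ → ℕ} {i : ℕ} (h : Type1At lam i) :
    reduceAt lam i = red1 lam i :=
  if_pos h.2

theorem Type2At.reduceAt_eq {par : ℕ → Prop} {lam : ℕ → ℕ} {i : ℕ} (h : Type2At par lam i) :
    reduceAt lam i = red2 lam i :=
  if_neg (by have := h.2.2.2.1; omega)

theorem Type1At.two_le {lam : ℕ → ℕ} (hd : WeaklyDecreasing lam) {i : ℕ} (h : Type1At lam i)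
    {k : ℕ} (hk : 1 ≤ k) (hki : k ≤ i) : 2 ≤ lam k := by
  have := hd.le hk hki
  have := h.2
  omega

theorem Type2At.two_le {lam : ℕ → ℕ} (hd : WeaklyDecreasing lam) {i : ℕ}
    (h : Type2At Odd lam i) {k : ℕ} (hk : 1 ≤ k) (hki : k < i) : 2 ≤ lam k := by
  have := hd.le hk (Nat.le_sub_one_of_lt hki)
  have := h.2.2.1 (by omega)
  have := h.2.1.pos
  omega

theorem WeaklyDecreasing.reduceAt {lam : ℕ → ℕ} (hd : WeaklyDecreasing lam) {i : ℕ}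
    (h : AdmissibleAt Odd lam i) : WeaklyDecreasing (reduceAt lam i) := by
  intro k hk
  have hk' := hd k hk
  rcases h with h | h
  · rw [h.reduceAt_eq]
    obtain ⟨hi, h2⟩ := h
    unfold red1
    grind
  · rw [h.reduceAt_eq]
    obtain ⟨hi, hodd, hprev, heq, hnext⟩ := h
    unfold red2
    grind

/-- Reductions at different positions commute, and the second position was already admissible. -/
theorem admissibleAt_swap {lam : ℕ → ℕ} (hd : WeaklyDecreasing lam) {i j : ℕ} (hij : i ≠ j)
    (hi : AdmissibleAt Odd lam i) (hj : AdmissibleAt Odd (reduceAt lam i) j) :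
    AdmissibleAt Odd lam j ∧ AdmissibleAt Odd (reduceAt lam j) i ∧
      reduceAt (reduceAt lam j) i = reduceAt (reduceAt lam i) j := by
  rcases hi with hi | hi <;> rw [hi.reduceAt_eq] at hj ⊢ <;> rcases hj with hj | hj <;>
    rw [hj.reduceAt_eq]
  · have hge : ∀ k, 1 ≤ k → k ≤ i → 2 ≤ lam k := fun k => hi.two_le hd
    have hj' : Type1At lam j := by
      unfold Type1At red1 at *
      grind
    have hge' : ∀ k, 1 ≤ k → k ≤ j → 2 ≤ lam k := fun k => hj'.two_le hd
    rw [hj'.reduceAt_eq]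
    have hi' : Type1At (red1 lam j) i := by
      unfold Type1At red1 at *
      grind
    refine ⟨.inl hj', .inl hi', ?_⟩
    rw [hi'.reduceAt_eq]
    funext k
    unfold red1
    grind
  · have hge : ∀ k, 1 ≤ k → k ≤ i → 2 ≤ lam k := fun k => hi.two_le hd
    have hj' : Type2At Odd lam j := by
      unfold Type1At Type2At red1 at *
      grind
    have hge' : ∀ k, 1 ≤ k → k < j → 2 ≤ lam k := fun k => hj'.two_le hd
    rw [hj'.reduceAt_eq]
    have hi' : Type1At (red2 lam j) i := by
      unfold Type1At Type2At red1 red2 at *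
      grind
    refine ⟨.inr hj', .inl hi', ?_⟩
    rw [hi'.reduceAt_eq]
    funext k
    unfold red1 red2
    grind
  · have hge : ∀ k, 1 ≤ k → k < i → 2 ≤ lam k := fun k => hi.two_le hd
    have hj' : Type1At lam j := by
      unfold Type1At Type2At red2 at *
      grind
    have hge' : ∀ k, 1 ≤ k → k ≤ j → 2 ≤ lam k := fun k => hj'.two_le hd
    rw [hj'.reduceAt_eq]
    have hi' : Type2At Odd (red1 lam j) i := by
      unfold Type1At Type2At red1 red2 at *
      grind
    refine ⟨.inl hj', .inr hi', ?_⟩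
    rw [hi'.reduceAt_eq]
    funext k
    unfold red1 red2
    grind
  · have hge : ∀ k, 1 ≤ k → k < i → 2 ≤ lam k := fun k => hi.two_le hd
    have hj' : Type2At Odd lam j := by
      unfold Type2At red2 at *
      grind
    have hge' : ∀ k, 1 ≤ k → k < j → 2 ≤ lam k := fun k => hj'.two_le hd
    rw [hj'.reduceAt_eq]
    have hi' : Type2At Odd (red2 lam j) i := by
      unfold Type2At red2 at *
      grind
    refine ⟨.inr hj', .inr hi', ?_⟩
    rw [hi'.reduceAt_eq]
    funext k
    unfold red2
    grind

/-- Any reordering of an admissible sequence is admissible, with the same result. -/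
theorem AdmissibleSeq.perm {l l' : List ℕ} (hperm : l.Perm l') {lam : ℕ → ℕ}
    (hd : WeaklyDecreasing lam) (hl : AdmissibleSeq Odd lam l) :
    AdmissibleSeq Odd lam l' ∧ reduceList lam l' = reduceList lam l := by
  induction hperm generalizing lam with
  | nil => exact ⟨hl, rfl⟩
  | cons i _ ih =>
    obtain ⟨hi, hl⟩ := hl
    obtain ⟨hl', heq⟩ := ih (hd.reduceAt hi) hl
    exact ⟨⟨hi, hl'⟩, heq⟩
  | swap i j l =>
    obtain ⟨hj, hi, hl⟩ := hl
    rcases eq_or_ne j i with rfl | hne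
    · exact ⟨⟨hj, hi, hl⟩, rfl⟩
    · obtain ⟨hi', hj', heq⟩ := admissibleAt_swap hd hne hj hi
      refine ⟨⟨hi', hj', ?_⟩, ?_⟩
      · rwa [heq]
      · simp only [reduceList, heq]
  | trans _ _ ih₁ ih₂ =>
    obtain ⟨h₁, heq₁⟩ := ih₁ hd hl
    obtain ⟨h₂, heq₂⟩ := ih₂ hd h₁
    exact ⟨h₂, heq₂.trans heq₁⟩

/-- any reordering of a maximal admissible sequence for an orthogonal
partition is again a maximal admissible sequence, with the same resulting partition. -/
theorem ks_reorder_orthogonal (lam : ℕ → ℕ) (hlam : IsOrthogonal lam)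
    (l l' : List ℕ) (hl : MaxAdmissibleSeq Odd lam l) (hperm : l'.Perm l) :
    MaxAdmissibleSeq Odd lam l' ∧ reduceList lam l' = reduceList lam l := by
  obtain ⟨hadm, heq⟩ := hl.1.perm hperm.symm hlam.1.1
  exact ⟨⟨hadm, heq ▸ hl.2⟩, heq⟩
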